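/- arXiv:2203.16709 — 2 statements merged into one kernel-verified Lean document; each statement's English description precedes it below -/
import Mathlib

section
/- Let D > 1 be a squarefree integer with D ≡ 1 or 2 (mod 4) such that every element of the ideal class group of ℚ(√−D) has order dividing 2. Let c > 1 be an odd integer with prime factorization c = p₁^{n₁} ⋯ p_k^{n_k} into k distinct odd primes, and suppose the Legendre symbol (−D/pᵢ) equals 1 for every i ≤ k. Then the number of normalized solutions of x² + Dy² = z² of the form (a, b, c) is exactly 2^{k−1}. -/
open scoped nonZeroDivisors in
theorem sq_principal_aux {R : Type*} [CommRing R] [IsDomain R]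
    (hclass : ∀ x : ClassGroup R, x ^ 2 = 1) (I J : Ideal R) (c : R) (hc : c ≠ 0)
    (hIJ : I * J = Ideal.span {c}) : (I ^ 2).IsPrincipal := by
  have hu : IsUnit (I : FractionalIdeal R⁰ (FractionRing R)) := by
    have h2 : (I : FractionalIdeal R⁰ (FractionRing R)) * J =
        FractionalIdeal.spanSingleton R⁰ (algebraMap R (FractionRing R) c) := by
      rw [← FractionalIdeal.coeIdeal_mul, hIJ, FractionalIdeal.coeIdeal_span_singleton]
    have hc' : algebraMap R (FractionRing R) c ≠ 0 := by
      simpa using hc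
    refine IsUnit.of_mul_eq_one (J * FractionalIdeal.spanSingleton R⁰ (algebraMap R (FractionRing R) c)⁻¹) ?_
    rw [← mul_assoc, h2, FractionalIdeal.spanSingleton_mul_spanSingleton, mul_inv_cancel₀ hc',
      FractionalIdeal.spanSingleton_one]
  obtain ⟨u, hu⟩ := hu
  have h1 := hclass (ClassGroup.mk (FractionRing R) u)
  rw [← map_pow, ClassGroup.mk_eq_one_iff] at h1
  have h3 : ((u ^ 2 : (FractionalIdeal R⁰ (FractionRing R))ˣ) : FractionalIdeal R⁰ (FractionRing R)) =
      ((I ^ 2 : Ideal R) : FractionalIdeal R⁰ (FractionRing R)) := by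
    rw [FractionalIdeal.coeIdeal_pow, ← hu]; simp
  rw [h3] at h1
  exact (IsFractionRing.coeSubmodule_isPrincipal (R := R) (K := FractionRing R) (I := I ^ 2)).1
    (by simpa using h1)

theorem exists_sol_aux (D : ℕ) (hD : 1 < D) [IsDomain (ℤ√(-(D : ℤ)))]
    (hclass : ∀ x : ClassGroup (ℤ√(-(D : ℤ))), x ^ 2 = 1)
    (c : ℤ) (hc : c ≠ 0) (r : ℤ) (hr : c ^ 2 ∣ r ^ 2 + D) (hrc : IsCoprime (2 * r) c) :
    ∃ a b : ℤ, a ^ 2 + D * b ^ 2 = c ^ 2 ∧ c ^ 2 ∣ a + r * b ∧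
      ∀ p : ℤ, p ∣ a → p ∣ b → p ∣ c → IsUnit p := by
  set d : ℤ := -(D : ℤ) with hd
  obtain ⟨m, hm⟩ := hr
  let w : ℤ√d := ⟨r, -1⟩
  let w' : ℤ√d := ⟨r, 1⟩
  have hww : w * w' = (c : ℤ√d) ^ 2 * (m : ℤ√d) := by
    have : (c : ℤ√d) ^ 2 * (m : ℤ√d) = ((c ^ 2 * m : ℤ) : ℤ√d) := by push_cast; ring
    rw [this, ← hm]
    have e2 : ((r ^ 2 + (D : ℤ) : ℤ) : ℤ√d).re = r ^ 2 + D := Zsqrtd.re_intCast _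
    have e3 : ((r ^ 2 + (D : ℤ) : ℤ) : ℤ√d).im = 0 := Zsqrtd.im_intCast _
    ext
    · rw [e2, Zsqrtd.re_mul]; simp only [w, w']; rw [hd]; ring
    · rw [e3, Zsqrtd.im_mul]; simp only [w, w']; ring
  have hws : w + w' = ((2 * r : ℤ) : ℤ√d) := by
    ext <;> simp [w, w']; ring
  have hcz : (c : ℤ√d) ≠ 0 := by
    intro h
    have := congrArg Zsqrtd.re h
    simp at this
    exact hc this
  let I : Ideal (ℤ√d) := Ideal.span {(c : ℤ√d), w}
  let J : Ideal (ℤ√d) := Ideal.span {(c : ℤ√d), w'}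
  have hIJ : I * J = Ideal.span {(c : ℤ√d)} := by
    apply le_antisymm
    · rw [Ideal.span_mul_span', Ideal.span_le]
      rintro x hx
      obtain ⟨y, hy, z, hz, rfl⟩ := Set.mem_mul.1 hx
      simp only [Set.mem_insert_iff, Set.mem_singleton_iff] at hy hz
      simp only [SetLike.mem_coe, Ideal.mem_span_singleton]
      rcases hy with rfl | rfl
      · exact Dvd.intro _ rfl
      · rcases hz with rfl | rfl
        · exact Dvd.intro_left _ rfl
        · rw [hww]; exact ⟨c * m, by ring⟩
    · rw [Ideal.span_singleton_le_iff_mem]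
      obtain ⟨u, v, huv⟩ := hrc
      have h1 : (c : ℤ√d) ∈ I := Ideal.subset_span (by simp)
      have h2 : (c : ℤ√d) ∈ J := Ideal.subset_span (by simp)
      have h3 : w ∈ I := Ideal.subset_span (by simp)
      have h4 : w' ∈ J := Ideal.subset_span (by simp)
      have e : (c : ℤ√d) = (u : ℤ√d) * (w * c + c * w') + (v : ℤ√d) * (c * c) := by
        have e2 := congrArg (Int.cast : ℤ → ℤ√d) huv
        rw [Int.cast_add, Int.cast_mul, ← hws] at e2
        push_cast at e2
        linear_combination -(c : ℤ√d) * e2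
      have : (u : ℤ√d) * (w * c + c * w') + (v : ℤ√d) * (c * c) ∈ I * J :=
        Ideal.add_mem _ (Ideal.mul_mem_left _ _ (Ideal.add_mem _ (Ideal.mul_mem_mul h3 h2)
          (Ideal.mul_mem_mul h1 h4))) (Ideal.mul_mem_left _ _ (Ideal.mul_mem_mul h1 h2))
      rwa [← e] at this
  have hprin := sq_principal_aux hclass I J c hcz hIJ
  obtain ⟨α, hα⟩ := hprin.principal
  rw [Ideal.submodule_span_eq] at hα
  have hdvd : ∀ x ∈ I, ∀ y ∈ I, α ∣ x * y := by
    intro x hx y hy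
    rw [← Ideal.mem_span_singleton, ← hα, pow_two]
    exact Ideal.mul_mem_mul hx hy
  have h1 : (c : ℤ√d) ∈ I := Ideal.subset_span (by simp)
  have h3 : w ∈ I := Ideal.subset_span (by simp)
  -- conj
  have hJmap : J = I.map (starRingEnd (ℤ√d)) := by
    rw [Ideal.map_span, Set.image_pair]
    have e1 : starRingEnd (ℤ√d) (c : ℤ√d) = c := by simp
    have e2 : starRingEnd (ℤ√d) w = w' := by
      ext <;> simp [w, w', starRingEnd_apply]
    rw [e1, e2]
  have hJ2 : J ^ 2 = Ideal.span {star α} := by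
    rw [hJmap, ← Ideal.map_pow, hα, Ideal.map_span, Set.image_singleton, starRingEnd_apply]
  have hN : Ideal.span {((α.norm : ℤ) : ℤ√d)} = Ideal.span {((c ^ 2 : ℤ) : ℤ√d)} := by
    rw [Zsqrtd.norm_eq_mul_conj, ← Ideal.span_singleton_mul_span_singleton, ← hα, ← hJ2,
      ← mul_pow, hIJ, Ideal.span_singleton_pow]
    push_cast; rfl
  have hN2 : α.norm = c ^ 2 := by
    apply Int.dvd_antisymm (Zsqrtd.norm_nonneg (by omega) _) (sq_nonneg _)
    · rw [← Zsqrtd.intCast_dvd_intCast (d := d), ← Ideal.span_singleton_le_span_singleton, hN]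
    · rw [← Zsqrtd.intCast_dvd_intCast (d := d), ← Ideal.span_singleton_le_span_singleton, hN]
  refine ⟨α.re, α.im, ?_, ?_, ?_⟩
  · rw [← hN2, Zsqrtd.norm_def]; ring
  · -- lift
    have hα2 : α ∈ I ^ 2 := by rw [hα]; exact Ideal.mem_span_singleton_self α
    have hle : I ^ 2 ≤ Ideal.span {((c ^ 2 : ℤ) : ℤ√d), w} := by
      rw [pow_two, Ideal.span_mul_span', Ideal.span_le]
      rintro x hx
      obtain ⟨y, hy, z, hz, rfl⟩ := Set.mem_mul.1 hx
      have k1 : ((c ^ 2 : ℤ) : ℤ√d) ∈ Ideal.span {((c ^ 2 : ℤ) : ℤ√d), w} :=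
        Ideal.subset_span (by simp)
      have k2 : w ∈ Ideal.span {((c ^ 2 : ℤ) : ℤ√d), w} := Ideal.subset_span (by simp)
      simp only [Set.mem_insert_iff, Set.mem_singleton_iff] at hy hz
      rcases hy with rfl | rfl
      · rcases hz with rfl | rfl
        · simpa [pow_two] using k1
        · exact Ideal.mul_mem_left _ _ k2
      · exact Ideal.mul_mem_right _ _ k2
    obtain ⟨x, y, hxy⟩ := Ideal.mem_span_pair.1 (hle hα2)
    rw [← hxy]
    refine ⟨x.re + r * x.im + m * y.im, ?_⟩
    simp [w, Zsqrtd.re_mul, Zsqrtd.im_mul]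
    have : (r ^ 2 + D) = c ^ 2 * m := hm
    simp [pow_two] at this ⊢
    linear_combination y.im * this
  · intro p ha hb hpc
    have hpα : (p : ℤ√d) ∣ α := (Zsqrtd.intCast_dvd _ _).2 ⟨ha, hb⟩
    have := (Zsqrtd.intCast_dvd _ _).1 (hpα.trans (hdvd w h3 w h3))
    have h5 : p ∣ 2 * r := by
      have := this.2
      simp [w] at this
      obtain ⟨k, hk⟩ := this
      exact ⟨-k, by linarith⟩
    exact hrc.isUnit_of_dvd' h5 hpc

open Polynomial in
theorem root_pp_aux (D : ℤ) (p : ℕ) (hp : p.Prime) (hp2 : p ≠ 2) (m : ℕ) (hm : m ≠ 0)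
    (h : @legendreSym p ⟨hp⟩ D = 1) :
    Nat.card {r : ZMod (p ^ m) // r ^ 2 = (D : ZMod (p ^ m))} = 2 := by
  have : Fact p.Prime := ⟨hp⟩
  have hD0 : (D : ZMod p) ≠ 0 := by
    intro h0
    rw [(legendreSym.eq_zero_iff p D).2 h0] at h
    exact zero_ne_one h
  obtain ⟨x, hx⟩ := (legendreSym.eq_one_iff p hD0).1 h
  have : NeZero (p ^ m) := ⟨pow_ne_zero _ hp.ne_zero⟩
  have hpD : ¬ (p : ℤ) ∣ D := fun hh => hD0 ((ZMod.intCast_zmod_eq_zero_iff_dvd D p).2 hh)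
  -- integer lift
  obtain ⟨y, rfl⟩ := ZMod.intCast_surjective x
  have hy : (p : ℤ) ∣ y ^ 2 - D := by
    rw [← ZMod.intCast_zmod_eq_zero_iff_dvd]; push_cast; rw [hx]; ring
  have hunit : ∀ z : ℤ, ¬ (p : ℤ) ∣ z → IsUnit (z : ZMod (p ^ m)) := by
    intro z hz
    have : IsCoprime z ((p ^ m : ℕ) : ℤ) := by
      push_cast
      exact ((Nat.prime_iff_prime_int.1 hp).coprime_iff_not_dvd.2 hz).symm.pow_right
    obtain ⟨u, v, huv⟩ := this
    have := congrArg (Int.cast : ℤ → ZMod (p ^ m)) huv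
    rw [Int.cast_add, Int.cast_mul, Int.cast_mul, Int.cast_natCast, ZMod.natCast_self] at this
    refine IsUnit.of_mul_eq_one (u : ZMod (p ^ m)) ?_
    simpa [mul_comm] using this
  have hp2' : ¬ (p : ℤ) ∣ 2 := by
    intro hh
    have : p ∣ 2 := by exact_mod_cast hh
    exact hp2 ((Nat.prime_dvd_prime_iff_eq hp Nat.prime_two).1 this)
  have hyp : ∀ y : ℤ, (p : ℤ) ∣ y ^ 2 - D → ¬ (p : ℤ) ∣ 2 * y := by
    intro y hy hh
    rcases (Nat.prime_iff_prime_int.1 hp).dvd_or_dvd hh with h1 | h1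
    · exact hp2' h1
    · apply hpD
      have := dvd_sub (dvd_pow h1 two_ne_zero) hy
      simpa using this
  have hnil : ∀ z : ℤ, (p : ℤ) ∣ z → IsNilpotent (z : ZMod (p ^ m)) := by
    rintro z ⟨k, rfl⟩
    refine ⟨m, ?_⟩
    rw [← Int.cast_pow, mul_pow, Int.cast_mul]
    have : (((p : ℤ) ^ m : ℤ) : ZMod (p ^ m)) = ((p ^ m : ℕ) : ZMod (p ^ m)) := by push_cast; rfl
    rw [this, ZMod.natCast_self, zero_mul]
  obtain ⟨r, ⟨-, hr⟩, -⟩ := Polynomial.existsUnique_nilpotent_sub_and_aeval_eq_zero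
    (R := ℤ) (S := ZMod (p ^ m)) (P := X ^ 2 - C D) (x := (y : ZMod (p ^ m)))
    (by simpa using hnil _ hy) (by
      rw [show derivative (X ^ 2 - C D) = C 2 * X by simp]
      have := hunit _ (hyp y hy)
      rw [map_mul, aeval_C, aeval_X]
      rw [Int.cast_mul] at this
      exact this)
  have hr : r ^ 2 = (D : ZMod (p ^ m)) := by
    simpa [sub_eq_zero] using hr
  have hdiv : ∀ z : ℤ, (z : ZMod (p ^ m)) = 0 ↔ (p : ℤ) ^ m ∣ z := by
    intro z
    rw [ZMod.intCast_zmod_eq_zero_iff_dvd]; push_cast; rfl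
  have hne : r ≠ -r := by
    intro h0
    obtain ⟨z, rfl⟩ := ZMod.intCast_surjective r
    have h1 : (p : ℤ) ^ m ∣ 2 * z := by
      rw [← hdiv]; push_cast; linear_combination h0
    have h2 : (p : ℤ) ^ m ∣ z ^ 2 - D := by
      rw [← hdiv]; push_cast; linear_combination hr
    exact hyp z ((dvd_pow_self _ hm).trans h2) ((dvd_pow_self _ hm).trans h1)
  have hset : {s : ZMod (p ^ m) | s ^ 2 = (D : ZMod (p ^ m))} = {r, -r} := by
    ext s
    simp only [Set.mem_ofPred_eq, Set.mem_insert_iff, Set.mem_singleton_iff]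
    constructor
    · intro hs
      obtain ⟨z, rfl⟩ := ZMod.intCast_surjective r
      obtain ⟨s, rfl⟩ := ZMod.intCast_surjective s
      have h2 : (p : ℤ) ^ m ∣ z ^ 2 - D := by
        rw [← hdiv]; push_cast; linear_combination hr
      have h3 : (p : ℤ) ^ m ∣ (s - z) * (s + z) := by
        rw [← hdiv]; push_cast; linear_combination hs - hr
      have hP := Nat.prime_iff_prime_int.1 hp
      by_cases h4 : (p : ℤ) ∣ s - z
      · left
        have h5 : ¬ (p : ℤ) ∣ s + z := by
          intro h5
          apply hyp z ((dvd_pow_self _ hm).trans h2)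
          have := dvd_sub h5 h4
          ring_nf at this ⊢; exact this
        have h6 : IsCoprime ((p : ℤ) ^ m) (s + z) := (hP.coprime_iff_not_dvd.2 h5).pow_left
        have := (hdiv _).2 (h6.dvd_of_dvd_mul_right h3)
        push_cast at this
        linear_combination this
      · right
        have h6 : IsCoprime ((p : ℤ) ^ m) (s - z) := (hP.coprime_iff_not_dvd.2 h4).pow_left
        have := (hdiv _).2 (h6.dvd_of_dvd_mul_left h3)
        push_cast at this
        linear_combination this
    · rintro (rfl | rfl)
      · exact hr
      · rw [neg_sq]; exact hr
  have : Nat.card {r : ZMod (p ^ m) // r ^ 2 = (D : ZMod (p ^ m))} =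
      ({s : ZMod (p ^ m) | s ^ 2 = (D : ZMod (p ^ m))}).ncard := rfl
  rw [this, hset, Set.ncard_pair hne]

theorem root_mul_aux (D : ℤ) (a b : ℕ) (hab : a.Coprime b) :
    Nat.card {r : ZMod (a * b) // r ^ 2 = (D : ZMod (a * b))} =
    Nat.card {r : ZMod a // r ^ 2 = (D : ZMod a)} * Nat.card {r : ZMod b // r ^ 2 = (D : ZMod b)} := by
  rw [← Nat.card_prod]
  let e := ZMod.chineseRemainder hab
  have e1 : {r : ZMod (a * b) // r ^ 2 = (D : ZMod (a * b))} ≃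
      {q : ZMod a × ZMod b // q.1 ^ 2 = (D : ZMod a) ∧ q.2 ^ 2 = (D : ZMod b)} := by
    refine e.toEquiv.subtypeEquiv ?_
    intro r
    rw [← e.injective.eq_iff, map_pow, map_intCast, Prod.ext_iff]
    simp
  refine Nat.card_congr (e1.trans ?_)
  exact Equiv.subtypeProdEquivProd (p := fun r : ZMod a => r ^ 2 = (D : ZMod a))
    (q := fun r : ZMod b => r ^ 2 = (D : ZMod b))

theorem root_count_aux (D : ℤ) (c : ℕ) (hcodd : Odd c)
    (hleg : ∀ p, (hp : p.Prime) → p ∣ c → @legendreSym p ⟨hp⟩ D = 1) :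
    Nat.card {r : ZMod (c ^ 2) // r ^ 2 = (D : ZMod (c ^ 2))} = 2 ^ c.primeFactors.card := by
  induction c using Nat.recOnPosPrimePosCoprime with
  | prime_pow p n hp hn =>
    rw [← pow_mul, root_pp_aux D p hp ?_ (n * 2) (by omega) (hleg p hp (dvd_pow_self _ hn.ne')),
      Nat.primeFactors_prime_pow hn.ne' hp]
    · simp
    · rintro rfl
      have := hcodd.of_dvd_nat (dvd_pow_self 2 hn.ne')
      exact absurd this (by decide)
  | zero => exact absurd hcodd (by decide)
  | one =>
    have : (1 : ℕ) ^ 2 = 1 := rfl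
    rw [this]
    simp only [Nat.primeFactors_one, Finset.card_empty, pow_zero]
    rw [Nat.card_eq_one_iff_unique]
    exact ⟨⟨fun a b => Subtype.ext (Subsingleton.elim _ _)⟩, ⟨⟨0, Subsingleton.elim _ _⟩⟩⟩
  | coprime a b ha hb hab iha ihb =>
    rw [mul_pow, root_mul_aux D _ _ (hab.pow 2 2), hab.primeFactors_mul, Finset.card_union_of_disjoint
      hab.disjoint_primeFactors, pow_add,
      iha (hcodd.of_dvd_nat (Dvd.intro _ rfl)) fun p hp h => hleg p hp (h.mul_right _),
      ihb (hcodd.of_dvd_nat (Dvd.intro_left _ rfl)) fun p hp h => hleg p hp (h.mul_left _)]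

theorem uniq_aux (D N r a b a' b' : ℤ) (hD : 1 < D) (hN : 0 < N) (hr : N ∣ r ^ 2 + D)
    (h : a ^ 2 + D * b ^ 2 = N) (h' : a' ^ 2 + D * b' ^ 2 = N)
    (ha : N ∣ a + r * b) (ha' : N ∣ a' + r * b') :
    (a = a' ∧ b = b') ∨ (a = -a' ∧ b = -b') := by
  have h1 : N ∣ a * a' + D * (b * b') := by
    have e : a * a' + D * (b * b') = (a + r * b) * a' - r * b * (a' + r * b') + (r ^ 2 + D) * (b * b') := by
      ring
    rw [e]
    exact dvd_add (dvd_sub (ha.mul_right _) (ha'.mul_left _)) (hr.mul_right _)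
  have h2 : N ∣ a * b' - a' * b := by
    have e : a * b' - a' * b = (a + r * b) * b' - (a' + r * b') * b := by ring
    rw [e]
    exact dvd_sub (ha.mul_right _) (ha'.mul_right _)
  obtain ⟨X, hX⟩ := h1
  obtain ⟨Y, hY⟩ := h2
  have h3 : N ^ 2 * (X ^ 2 + D * Y ^ 2) = N ^ 2 * 1 := by
    have : (a * a' + D * (b * b')) ^ 2 + D * (a * b' - a' * b) ^ 2 = N ^ 2 := by
      have : N ^ 2 = (a ^ 2 + D * b ^ 2) * (a' ^ 2 + D * b' ^ 2) := by rw [h, h']; ring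
      rw [this]; ring
    rw [hX, hY] at this
    linear_combination this
  have h4 := mul_left_cancel₀ (pow_ne_zero 2 hN.ne') h3
  have hY0 : Y = 0 := by
    by_contra hne
    have : 0 < Y ^ 2 := by positivity
    nlinarith [sq_nonneg X]
  subst hY0
  have hX1 : X = 1 ∨ X = -1 := by
    have : X ^ 2 = 1 := by simpa using h4
    exact by rcases sq_eq_sq_iff_eq_or_eq_neg.1 (this.trans (one_pow 2).symm) with h | h <;> simp [h]
  have k1 : N * a = N * (X * a') := by
    have e : (a * a' + D * (b * b')) * a' + D * b' * (a * b' - a' * b) = a * (a' ^ 2 + D * b' ^ 2) := by ring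
    rw [hX, hY, h'] at e
    linear_combination -e
  have k2 : N * b = N * (X * b') := by
    have e : (a * a' + D * (b * b')) * b' - a' * (a * b' - a' * b) = b * (a' ^ 2 + D * b' ^ 2) := by ring
    rw [hX, hY, h'] at e
    linear_combination -e
  have k1 := mul_left_cancel₀ hN.ne' k1
  have k2 := mul_left_cancel₀ hN.ne' k2
  rcases hX1 with rfl | rfl
  · left; simpa using And.intro k1 k2
  · right; simpa using And.intro k1 k2

/-- **Theorem 4.1 of [JMMM] (counting part).**
Let `D > 1` be a squarefree integer with `D ≡ 1` or `2 (mod 4)` such that every element of the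
ideal class group of `ℚ(√-D)` (equivalently, of its ring of integers `ℤ[√-D]`) has order
dividing 2.  Let `c > 1` be an odd integer whose (distinct) prime factors `p` all satisfy
`(-D/p) = 1` (Legendre symbol).  Then the number of normalized solutions `(a, b, c)` of
`x² + D y² = z²` (positive integers with `a² + D b² = c²` and `gcd(a, b, c) = 1`) is exactly
`2 ^ (k - 1)`, where `k` is the number of distinct prime factors of `c`. -/
theorem count_normalized_solutions
    (D : ℕ) (hD : 1 < D) (hsf : Squarefree D) (hDmod : D % 4 = 1 ∨ D % 4 = 2)
    [IsDomain (ℤ√(-(D : ℤ)))]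
    (hclass : ∀ x : ClassGroup (ℤ√(-(D : ℤ))), x ^ 2 = 1)
    (c : ℕ) (hc : 1 < c) (hcodd : Odd c)
    (hleg : ∀ p, (hp : p.Prime) → p ∣ c → @legendreSym p ⟨hp⟩ (-(D : ℤ)) = 1) :
    {ab : ℕ × ℕ | 0 < ab.1 ∧ 0 < ab.2 ∧ ab.1 ^ 2 + D * ab.2 ^ 2 = c ^ 2 ∧
        Nat.gcd (Nat.gcd ab.1 ab.2) c = 1}.ncard
      = 2 ^ (c.primeFactors.card - 1) := by
  have hc0 : 0 < c := by omega
  set R := {r : ZMod (c ^ 2) // r ^ 2 = ((-(D : ℤ) : ℤ) : ZMod (c ^ 2))} with hR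
  have hcard : Nat.card R = 2 ^ c.primeFactors.card := root_count_aux _ c hcodd hleg
  set S := {ab : ℕ × ℕ | 0 < ab.1 ∧ 0 < ab.2 ∧ ab.1 ^ 2 + D * ab.2 ^ 2 = c ^ 2 ∧
        Nat.gcd (Nat.gcd ab.1 ab.2) c = 1} with hS
  have hDc : Nat.Coprime D c := by
    apply Nat.Coprime.symm
    apply Nat.coprime_of_dvd
    intro p hp hpc hpD
    have : Fact p.Prime := ⟨hp⟩
    have := hleg p hp hpc
    rw [(legendreSym.eq_zero_iff p (-(D : ℤ))).2 (by
      rw [ZMod.intCast_zmod_eq_zero_iff_dvd]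
      exact (Int.natCast_dvd_natCast.2 hpD).neg_right)] at this
    exact zero_ne_one this
  have hdiv : ∀ z : ℤ, (z : ZMod (c ^ 2)) = 0 ↔ ((c : ℤ)) ^ 2 ∣ z := by
    intro z
    rw [ZMod.intCast_zmod_eq_zero_iff_dvd]; push_cast; rfl
  have hbc : ∀ s ∈ S, Nat.Coprime s.2 c := by
    rintro ⟨a, b⟩ ⟨h1, h2, h3, h4⟩
    simp only at h1 h2 h3 h4 ⊢
    apply Nat.coprime_of_dvd
    intro p hp hpb hpc
    have : p ∣ a ^ 2 := by
      have h5 : p ∣ D * b ^ 2 := (dvd_pow hpb two_ne_zero).mul_left _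
      have h6 : p ∣ a ^ 2 + D * b ^ 2 := by rw [h3]; exact dvd_pow hpc two_ne_zero
      exact (Nat.dvd_add_left h5).1 h6
    have hpa := hp.dvd_of_dvd_pow this
    have : p ∣ 1 := by rw [← h4]; exact Nat.dvd_gcd (Nat.dvd_gcd hpa hpb) hpc
    exact hp.one_lt.ne' (Nat.dvd_one.1 this)
  have hinv : ∀ s ∈ S, (s.2 : ZMod (c ^ 2)) * (s.2 : ZMod (c ^ 2))⁻¹ = 1 := fun s hs =>
    ZMod.coe_mul_inv_eq_one _ ((hbc s hs).pow_right 2)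
  have heq : ∀ s ∈ S, (s.1 : ZMod (c ^ 2)) ^ 2 + D * (s.2 : ZMod (c ^ 2)) ^ 2 = 0 := by
    intro s hs
    have := congrArg (Nat.cast : ℕ → ZMod (c ^ 2)) hs.2.2.1
    rw [ZMod.natCast_self] at this
    exact_mod_cast this
  have hsg : ∀ ε : ℤˣ, (((ε : ℤ) : ℤ) : ZMod (c ^ 2)) ^ 2 = 1 := by
    intro ε
    rcases Int.units_eq_one_or ε with rfl | rfl <;> simp
  let f : S × ℤˣ → R := fun q => ⟨-(((q.2 : ℤ) : ZMod (c ^ 2))) * (q.1.1.1 : ZMod (c ^ 2)) *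
      (q.1.1.2 : ZMod (c ^ 2))⁻¹, by
    have h1 := hinv _ q.1.2
    have h2 := heq _ q.1.2
    have h3 := hsg q.2
    rw [mul_pow, mul_pow, neg_sq, h3]
    push_cast
    set a := (q.1.1.1 : ZMod (c ^ 2))
    set b := (q.1.1.2 : ZMod (c ^ 2))
    linear_combination (b⁻¹) ^ 2 * h2 - (D : ZMod (c ^ 2)) * (b * b⁻¹ + 1) * h1⟩
  have hf : Function.Bijective f := by
    constructor
    · rintro ⟨⟨⟨a, b⟩, hs⟩, ε⟩ ⟨⟨⟨a', b'⟩, hs'⟩, ε'⟩ hff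
      obtain ⟨r, hr⟩ := ZMod.intCast_surjective (f ⟨⟨⟨a, b⟩, hs⟩, ε⟩).1
      have hr' : (r : ZMod (c ^ 2)) = (f ⟨⟨⟨a', b'⟩, hs'⟩, ε'⟩).1 := by rw [hr, hff]
      have hrr := (f ⟨⟨⟨a, b⟩, hs⟩, ε⟩).2
      rw [← hr] at hrr
      have hrD : (c : ℤ) ^ 2 ∣ r ^ 2 + D := by
        rw [← hdiv]; push_cast; rw [hrr]; push_cast; ring
      have key : ∀ a b : ℕ, (a, b) ∈ S → ∀ ε : ℤˣ, (r : ZMod (c ^ 2)) =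
          -(((ε : ℤ) : ZMod (c ^ 2))) * (a : ZMod (c ^ 2)) * (b : ZMod (c ^ 2))⁻¹ →
          (c : ℤ) ^ 2 ∣ ((ε : ℤ) * a) + r * b := by
        intro a b hs ε h
        have h1 := hinv _ hs
        simp only at h1
        rw [← hdiv]
        push_cast
        rw [h]
        linear_combination -(((ε : ℤ) : ZMod (c ^ 2))) * (a : ZMod (c ^ 2)) * h1
      have k1 := key a b hs ε hr
      have k2 := key a' b' hs' ε' hr'
      have hz : ∀ a b : ℕ, (a, b) ∈ S → ∀ ε : ℤˣ,
          ((ε : ℤ) * a) ^ 2 + (D : ℤ) * (b : ℤ) ^ 2 = (c : ℤ) ^ 2 := by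
        intro a b hs ε
        have := hs.2.2.1
        simp only at this
        have e : (ε : ℤ) ^ 2 = 1 := by
          rcases Int.units_eq_one_or ε with rfl | rfl <;> simp
        rw [mul_pow, e]
        exact_mod_cast (by simpa using this)
      have hb : 0 < b := hs.2.1
      have hb' : 0 < b' := hs'.2.1
      have ha : 0 < a := hs.1
      have ha' : 0 < a' := hs'.1
      rcases uniq_aux D ((c : ℤ) ^ 2) r _ _ _ _ (by exact_mod_cast hD) (by positivity) hrD
        (hz a b hs ε) (hz a' b' hs' ε') k1 k2 with ⟨e1, e2⟩ | ⟨e1, e2⟩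
      · have e2 : b = b' := by exact_mod_cast e2
        subst e2
        rcases Int.units_eq_one_or ε with rfl | rfl <;> rcases Int.units_eq_one_or ε' with rfl | rfl
        · have : a = a' := by simpa using e1
          subst this; rfl
        · exfalso; simp at e1; omega
        · exfalso; simp at e1; omega
        · have : a = a' := by simpa using e1
          subst this; rfl
      · omega
    · rintro ⟨t, ht⟩
      obtain ⟨r, rfl⟩ := ZMod.intCast_surjective t
      have hrD : (c : ℤ) ^ 2 ∣ r ^ 2 + D := by
        rw [← hdiv]; push_cast; rw [ht]; push_cast; ring
      have hrc : IsCoprime (2 * r) (c : ℤ) := by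
        have h2 : IsCoprime (2 : ℤ) (c : ℤ) := by
          have : Nat.Coprime 2 c := (Nat.coprime_two_left).2 hcodd
          exact_mod_cast Nat.isCoprime_iff_coprime.2 this
        have h3 : IsCoprime (r ^ 2) (c : ℤ) := by
          have h4 : IsCoprime (-(D : ℤ)) (c : ℤ) := (Nat.isCoprime_iff_coprime.2 hDc).neg_left
          obtain ⟨k, hk⟩ := hrD
          have : r ^ 2 = -(D : ℤ) + (c : ℤ) * (c * k) := by linear_combination hk
          rw [this]
          exact h4.add_mul_left_left _
        exact h2.mul_left ((IsCoprime.pow_left_iff (by norm_num)).1 h3)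
      obtain ⟨a, b, hab, hd, hg⟩ := exists_sol_aux D hD hclass c (by exact_mod_cast hc0.ne') r hrD hrc
      have hcu : ¬ IsUnit (c : ℤ) := by
        rw [Int.isUnit_iff]; omega
      have ha0 : a ≠ 0 := by
        rintro rfl
        have h1 : D ∣ c ^ 2 := by
          have : (D : ℤ) ∣ (c : ℤ) ^ 2 := ⟨b ^ 2, by linear_combination -hab⟩
          exact_mod_cast this
        have h2 : Nat.Coprime D (c ^ 2) := hDc.pow_right 2
        have := Nat.Coprime.eq_one_of_dvd h2 h1
        omega
      have hb0 : b ≠ 0 := by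
        rintro rfl
        have h1 : a ^ 2 = (c : ℤ) ^ 2 := by linear_combination hab
        have h2 : (c : ℤ) ∣ a := (Int.pow_dvd_pow_iff two_ne_zero).1 (by rw [h1])
        exact hcu (hg c h2 (dvd_zero _) dvd_rfl)
      have hmem : (a.natAbs, b.natAbs) ∈ S := by
        refine ⟨Int.natAbs_pos.2 ha0, Int.natAbs_pos.2 hb0, ?_, ?_⟩
        · simp only
          zify
          rw [sq_abs, sq_abs]; exact hab
        · simp only
          set g := Nat.gcd (Nat.gcd a.natAbs b.natAbs) c with hgdef
          have g1 : g ∣ Nat.gcd a.natAbs b.natAbs := Nat.gcd_dvd_left _ _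
          have g2 : g ∣ c := Nat.gcd_dvd_right _ _
          have := hg g (Int.natCast_dvd.2 (g1.trans (Nat.gcd_dvd_left _ _)))
            (Int.natCast_dvd.2 (g1.trans (Nat.gcd_dvd_right _ _))) (Int.natCast_dvd_natCast.2 g2)
          rw [Int.isUnit_iff] at this
          omega
      have hsgn : ∃ ε : ℤˣ, (c : ℤ) ^ 2 ∣ (ε : ℤ) * (a.natAbs : ℤ) + r * (b.natAbs : ℤ) := by
        rcases Int.natAbs_eq a with h1 | h1 <;> rcases Int.natAbs_eq b with h2 | h2
        · exact ⟨1, by rw [← h1, ← h2]; simpa using hd⟩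
        · refine ⟨-1, ?_⟩
          rw [h1, h2] at hd
          obtain ⟨k, hk⟩ := hd
          exact ⟨-k, by rw [Units.val_neg, Units.val_one]; linear_combination -hk⟩
        · refine ⟨-1, ?_⟩
          rw [h1, h2] at hd
          obtain ⟨k, hk⟩ := hd
          exact ⟨k, by rw [Units.val_neg, Units.val_one]; linear_combination hk⟩
        · refine ⟨1, ?_⟩
          rw [h1, h2] at hd
          obtain ⟨k, hk⟩ := hd
          exact ⟨-k, by rw [Units.val_one]; linear_combination -hk⟩
      obtain ⟨ε, hε⟩ := hsgn
      refine ⟨⟨⟨_, hmem⟩, ε⟩, ?_⟩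
      apply Subtype.ext
      have h1 := hinv _ hmem
      rw [← hdiv, Int.cast_add, Int.cast_mul, Int.cast_mul, Int.cast_natCast, Int.cast_natCast] at hε
      simp only [f] at h1 ⊢
      generalize ((a.natAbs : ℕ) : ZMod (c ^ 2)) = A at *
      generalize ((b.natAbs : ℕ) : ZMod (c ^ 2)) = B at *
      linear_combination -B⁻¹ * hε + (r : ZMod (c ^ 2)) * h1
  have hfin := Nat.card_congr (Equiv.ofBijective f hf)
  rw [Nat.card_prod, hcard, Nat.card_eq_fintype_card (α := ℤˣ), Fintype.card_units_int] at hfin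
  have hk : 0 < c.primeFactors.card :=
    Finset.card_pos.2 (Nat.nonempty_primeFactors.2 hc)
  obtain ⟨k, hk⟩ := Nat.exists_eq_succ_of_ne_zero hk.ne'
  change Nat.card S = _
  rw [hk] at hfin ⊢
  rw [pow_succ] at hfin
  simpa using hfin
end

section
/- Let c > 1 be an integer with prime factorization c = p₁^{n₁} ⋯ p_k^{n_k} into k distinct primes, and suppose pᵢ ≡ 1 (mod 4) for all i ≤ k. Then the number of normalized Pythagorean triples of the form (a, b, c), i.e., pairs of positive integers (a, b) with a² + b² = c², gcd(a, b, c) = 1, and a ≤ b, is exactly 2^{k−1}. -/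
theorem cnpt_prime_pow (p n : ℕ) (hp : p.Prime) (hn : 0 < n) (h4 : p % 4 = 1) :
    {x : ZMod (p ^ n) | x ^ 2 = -1}.ncard = 2 := by
  haveI : Fact p.Prime := ⟨hp⟩
  obtain ⟨r, hr⟩ : ∃ r : ℤ, ((p : ℤ) ^ n) ∣ r ^ 2 + 1 := by
    obtain ⟨y, hy⟩ := ZMod.exists_sq_eq_neg_one_iff.mpr (show p % 4 ≠ 3 by omega)
    obtain ⟨k, rfl⟩ : ∃ k, n = k + 1 := ⟨n - 1, by omega⟩
    obtain ⟨s, rfl⟩ := ZMod.intCast_surjective y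
    have h1 : (p : ℤ) ∣ s ^ 2 - (-1) := by
      rw [← ZMod.intCast_zmod_eq_zero_iff_dvd]
      push_cast
      rw [pow_two, ← hy]; ring
    have h2 := dvd_sub_pow_of_dvd_sub h1 k
    have hodd : Odd (p ^ k) := Odd.pow (Nat.odd_iff.mpr (by omega))
    rw [hodd.neg_one_pow, ← pow_mul, mul_comm 2, pow_mul] at h2
    exact ⟨s ^ p ^ k, by simpa using h2⟩
  have hpp : Prime (p : ℤ) := Nat.prime_iff_prime_int.mp hp
  have hpd : (p : ℤ) ∣ (p : ℤ) ^ n := dvd_pow_self _ hn.ne'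
  have h5 : 5 ≤ p := by
    have := hp.two_le; omega
  have hnd : ¬ (p : ℤ) ∣ 2 * r := by
    intro h
    rcases hpp.dvd_or_dvd h with h | h
    · have := Int.le_of_dvd (by norm_num) h
      omega
    · have h1 : (p : ℤ) ∣ 1 := by
        have := dvd_sub (hpd.trans hr) (dvd_mul_of_dvd_left h r)
        rwa [show r ^ 2 + 1 - r * r = 1 by ring] at this
      have := Int.le_of_dvd (by norm_num) h1
      omega
  have hset : {x : ZMod (p ^ n) | x ^ 2 = -1} = {(r : ZMod (p ^ n)), -(r : ZMod (p ^ n))} := by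
    have hr0 : (r : ZMod (p ^ n)) ^ 2 = -1 := by
      have : ((r ^ 2 + 1 : ℤ) : ZMod (p ^ n)) = 0 := by
        rw [ZMod.intCast_zmod_eq_zero_iff_dvd]; exact_mod_cast hr
      push_cast at this
      linear_combination this
    ext x
    simp only [Set.mem_setOf_eq, Set.mem_insert_iff, Set.mem_singleton_iff]
    constructor
    · intro hx
      obtain ⟨s, rfl⟩ := ZMod.intCast_surjective x
      have h1 : ((p : ℤ) ^ n) ∣ (s - r) * (s + r) := by
        have : (((s - r) * (s + r) : ℤ) : ZMod (p ^ n)) = 0 := by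
          push_cast; linear_combination hx - hr0
        rw [ZMod.intCast_zmod_eq_zero_iff_dvd] at this
        exact_mod_cast this
      by_cases hd : (p : ℤ) ∣ s - r
      · left
        have hd2 : ¬ (p : ℤ) ∣ s + r := fun h => hnd (by
          have := dvd_sub h hd
          rwa [show s + r - (s - r) = 2 * r by ring] at this)
        have hc : IsCoprime ((p : ℤ) ^ n) (s + r) :=
          IsCoprime.pow_left ((Prime.coprime_iff_not_dvd hpp).mpr hd2)
        have h2 := hc.dvd_of_dvd_mul_right h1
        have : ((s - r : ℤ) : ZMod (p ^ n)) = 0 := by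
          rw [ZMod.intCast_zmod_eq_zero_iff_dvd]; exact_mod_cast h2
        push_cast at this
        linear_combination this
      · right
        have hc : IsCoprime ((p : ℤ) ^ n) (s - r) :=
          IsCoprime.pow_left ((Prime.coprime_iff_not_dvd hpp).mpr hd)
        have h2 := hc.dvd_of_dvd_mul_left h1
        have : ((s + r : ℤ) : ZMod (p ^ n)) = 0 := by
          rw [ZMod.intCast_zmod_eq_zero_iff_dvd]; exact_mod_cast h2
        push_cast at this
        linear_combination this
    · rintro (rfl | rfl)
      · exact hr0
      · rw [neg_sq]; exact hr0
  rw [hset, Set.ncard_pair]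
  intro h
  apply hnd
  refine hpd.trans ?_
  have : ((2 * r : ℤ) : ZMod (p ^ n)) = 0 := by
    push_cast; linear_combination h
  rw [ZMod.intCast_zmod_eq_zero_iff_dvd] at this
  exact_mod_cast this

theorem cnpt_roots (N : ℕ) : N ≠ 0 → (∀ p ∈ N.primeFactors, p % 4 = 1) →
    {x : ZMod N | x ^ 2 = -1}.ncard = 2 ^ N.primeFactors.card := by
  induction N using Nat.recOnPosPrimePosCoprime with
  | prime_pow p n hp hn =>
    intro _ h
    rw [Nat.primeFactors_prime_pow hn.ne' hp] at h ⊢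
    rw [cnpt_prime_pow p n hp hn (h p (by simp))]
    simp
  | zero => intro h; exact absurd rfl h
  | one =>
    intro _ _
    have : {x : ZMod 1 | x ^ 2 = -1} = {0} := by
      ext x
      simp [Subsingleton.elim x 0, eq_iff_true_of_subsingleton]
    rw [this]; simp
  | coprime a b ha hb hab iha ihb =>
    intro _ h
    rw [hab.primeFactors_mul] at h ⊢
    rw [Finset.card_union_of_disjoint hab.disjoint_primeFactors, pow_add,
      ← iha (by omega) (fun p hp => h p (Finset.mem_union_left _ hp)),
      ← ihb (by omega) (fun p hp => h p (Finset.mem_union_right _ hp)), ← Set.ncard_prod]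
    let e := ZMod.chineseRemainder hab
    rw [← Set.ncard_image_of_injective _ e.injective]
    congr 1
    ext y
    constructor
    · rintro ⟨x, hx, rfl⟩
      have : (e x) ^ 2 = -1 := by
        rw [← map_pow, (show x ^ 2 = -1 from hx), map_neg, map_one]
      exact ⟨congrArg Prod.fst this, congrArg Prod.snd this⟩
    · rintro ⟨h1, h2⟩
      refine ⟨e.symm y, ?_, e.apply_symm_apply y⟩
      have : y ^ 2 = -1 := Prod.ext h1 h2
      show (e.symm y) ^ 2 = -1
      rw [← map_pow, this, map_neg, map_one]

theorem cnpt_thue (c : ℕ) (hc : 1 < c) (X : ℤ) :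
    ∃ u v : ℤ, (u ≠ 0 ∨ v ≠ 0) ∧ |u| ≤ c ∧ |v| ≤ c ∧ ((c : ℤ) ^ 2) ∣ u - X * v := by
  haveI : NeZero (c ^ 2) := ⟨by positivity⟩
  obtain ⟨⟨a, b⟩, h1, ⟨a', b'⟩, h2, hne, heq⟩ :=
    Finset.exists_ne_map_eq_of_card_lt_of_maps_to
      (s := Finset.range (c + 1) ×ˢ Finset.range (c + 1)) (t := (Finset.univ : Finset (ZMod (c ^ 2))))
      (f := fun q => (((q.1 : ℤ) - X * (q.2 : ℤ) : ℤ) : ZMod (c ^ 2)))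
      (by simp [ZMod.card]; nlinarith) (fun _ _ => Finset.mem_univ _)
  simp only [Finset.mem_product, Finset.mem_range] at h1 h2
  refine ⟨(a : ℤ) - a', (b : ℤ) - b', ?_, ?_, ?_, ?_⟩
  · by_contra! h
    apply hne
    ext <;> simp <;> omega
  · rw [abs_le]; omega
  · rw [abs_le]; omega
  · have : (((a : ℤ) - a' - X * (b - b') : ℤ) : ZMod (c ^ 2)) = 0 := by
      simp only at heq
      push_cast at heq ⊢
      linear_combination heq
    rw [ZMod.intCast_zmod_eq_zero_iff_dvd] at this
    exact_mod_cast this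

theorem cnpt_int (c : ℕ) (hc : 1 < c) (hodd : c % 2 = 1) (X : ℤ) (hX : ((c : ℤ) ^ 2) ∣ X ^ 2 + 1) :
    ∃ u v : ℤ, u ≠ 0 ∧ v ≠ 0 ∧ u ^ 2 + v ^ 2 = (c : ℤ) ^ 2 ∧ Nat.Coprime u.natAbs v.natAbs ∧
      ((c : ℤ) ^ 2) ∣ u - X * v := by
  obtain ⟨u, v, h0, hu, hv, hd⟩ := cnpt_thue c hc X
  have hu2 : u ^ 2 ≤ (c : ℤ) ^ 2 := by rw [← sq_abs u]; gcongr
  have hv2 : v ^ 2 ≤ (c : ℤ) ^ 2 := by rw [← sq_abs v]; gcongr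
  have hpos : 0 < u ^ 2 + v ^ 2 := by
    rcases h0 with h | h
    · have := sq_nonneg v
      positivity
    · have := sq_nonneg u
      positivity
  have hcpos : (0 : ℤ) < (c : ℤ) ^ 2 := by positivity
  have key : ∀ m u v : ℤ, m ∣ u - X * v → m ∣ X ^ 2 + 1 → m ∣ u ^ 2 + v ^ 2 := by
    intro m u v h1 h2
    have := dvd_add (dvd_mul_of_dvd_left h1 (u + X * v)) (dvd_mul_of_dvd_left h2 (v ^ 2))
    rwa [show (u - X * v) * (u + X * v) + (X ^ 2 + 1) * v ^ 2 = u ^ 2 + v ^ 2 by ring] at this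
  obtain ⟨t, ht⟩ := key _ u v hd hX
  have ht0 : 0 < t := by
    by_contra! h
    nlinarith
  have ht2 : t ≤ 2 := by
    by_contra! h
    nlinarith
  have ht1 : t = 1 := by
    by_contra hne
    obtain rfl : t = 2 := by omega
    have e1 : u ^ 2 = (c : ℤ) ^ 2 := by linarith
    have e2 : v ^ 2 = (c : ℤ) ^ 2 := by linarith
    have hcc : (c : ℤ) ≠ 0 := by positivity
    have hX1 : (c : ℤ) ∣ X ^ 2 - 1 := by
      have : (c : ℤ) ^ 2 * c ∣ (c : ℤ) ^ 2 * (X ^ 2 - 1) := by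
        have hcs : (c : ℤ) ∣ u + X * v := by
          have a1 : (c : ℤ) ∣ u := (Int.pow_dvd_pow_iff two_ne_zero).mp (by rw [e1])
          have a2 : (c : ℤ) ∣ v := (Int.pow_dvd_pow_iff two_ne_zero).mp (by rw [e2])
          exact dvd_add a1 (dvd_mul_of_dvd_right a2 X)
        have := mul_dvd_mul hd hcs
        rw [show (u - X * v) * (u + X * v) = -((c : ℤ) ^ 2 * (X ^ 2 - 1)) by
          linear_combination e1 - X ^ 2 * e2] at this
        exact (dvd_neg.mp this)
      exact (mul_dvd_mul_iff_left hcpos.ne').mp this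
    have h2 : (c : ℤ) ∣ 2 := by
      have := dvd_sub ((dvd_pow_self (c : ℤ) two_ne_zero).trans hX) hX1
      rwa [show X ^ 2 + 1 - (X ^ 2 - 1) = 2 by ring] at this
    have := Int.le_of_dvd (by norm_num) h2
    omega
  rw [ht1, mul_one] at ht
  have hcop : Nat.Coprime u.natAbs v.natAbs := by
    apply Nat.Coprime.symm
    by_contra hnc
    obtain ⟨p, hp, hpv, hpu⟩ := Nat.Prime.not_coprime_iff_dvd.mp hnc
    rw [← Int.natCast_dvd] at hpu hpv
    obtain ⟨u', rfl⟩ := hpu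
    obtain ⟨v', rfl⟩ := hpv
    have hp0 : (p : ℤ) ≠ 0 := by exact_mod_cast hp.ne_zero
    have hN : (c : ℤ) ^ 2 = p * (p * (u' ^ 2 + v' ^ 2)) := by rw [← ht]; ring
    have hM : 0 < u' ^ 2 + v' ^ 2 := by
      rcases (by positivity : 0 ≤ u' ^ 2 + v' ^ 2).lt_or_eq with h | h
      · exact h
      · rw [← h] at hN; simp at hN; omega
    have h1 : (p : ℤ) * (u' ^ 2 + v' ^ 2) ∣ u' - X * v' := by
      rw [hN, show (p : ℤ) * u' - X * (p * v') = p * (u' - X * v') by ring] at hd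
      exact (mul_dvd_mul_iff_left hp0).mp hd
    have h2 := key _ _ _ h1 ((Dvd.intro_left _ hN.symm).trans hX)
    have h3 := Int.le_of_dvd hM h2
    have : (2 : ℤ) ≤ p := by exact_mod_cast hp.two_le
    nlinarith
  refine ⟨u, v, ?_, ?_, ht, hcop, hd⟩
  · rintro rfl
    simp at hcop
    have : v ^ 2 = 1 := by rw [← sq_abs, Int.abs_eq_natAbs, hcop]; rfl
    nlinarith
  · rintro rfl
    simp at hcop
    have : u ^ 2 = 1 := by rw [← sq_abs, Int.abs_eq_natAbs, hcop]; rfl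
    nlinarith

theorem cnpt_surj (c : ℕ) (hc : 1 < c) (hodd : c % 2 = 1) (x : ZMod (c ^ 2)) (hx : x ^ 2 = -1) :
    ∃ a b : ℕ, 0 < a ∧ 0 < b ∧ a ^ 2 + b ^ 2 = c ^ 2 ∧ Nat.Coprime a b ∧
      (a : ZMod (c ^ 2)) = x * (b : ZMod (c ^ 2)) := by
  obtain ⟨X, rfl⟩ := ZMod.intCast_surjective x
  have hX : ((c : ℤ) ^ 2) ∣ X ^ 2 + 1 := by
    have : ((X ^ 2 + 1 : ℤ) : ZMod (c ^ 2)) = 0 := by push_cast; rw [hx]; ring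
    rw [ZMod.intCast_zmod_eq_zero_iff_dvd] at this
    exact_mod_cast this
  obtain ⟨u, v, hu, hv, h, hcop, hd⟩ := cnpt_int c hc hodd X hX
  have hz : (u : ZMod (c ^ 2)) = X * v := by
    have : ((u - X * v : ℤ) : ZMod (c ^ 2)) = 0 := by
      rw [ZMod.intCast_zmod_eq_zero_iff_dvd]; exact_mod_cast hd
    push_cast at this
    linear_combination this
  have hn : u.natAbs ^ 2 + v.natAbs ^ 2 = c ^ 2 := by
    zify; simpa using h
  have hz2 : (v : ZMod (c ^ 2)) = - (X * u) := by
    rw [hz]; linear_combination (v : ZMod (c ^ 2)) * hx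
  have hU : 0 < u.natAbs := Int.natAbs_pos.mpr hu
  have hV : 0 < v.natAbs := Int.natAbs_pos.mpr hv
  have cu : ((u.natAbs : ℕ) : ZMod (c ^ 2)) = ((|u| : ℤ) : ZMod (c ^ 2)) := by
    rw [Int.abs_eq_natAbs]; simp
  have cv : ((v.natAbs : ℕ) : ZMod (c ^ 2)) = ((|v| : ℤ) : ZMod (c ^ 2)) := by
    rw [Int.abs_eq_natAbs]; simp
  rcases lt_or_gt_of_ne hu with su | su <;> rcases lt_or_gt_of_ne hv with sv | sv
  · refine ⟨_, _, hU, hV, hn, hcop, ?_⟩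
    rw [cu, cv, abs_of_neg su, abs_of_neg sv]; push_cast; rw [hz]; ring
  · refine ⟨_, _, hV, hU, by rw [add_comm]; exact hn, hcop.symm, ?_⟩
    rw [cu, cv, abs_of_neg su, abs_of_pos sv]; push_cast; rw [hz2]; ring
  · refine ⟨_, _, hV, hU, by rw [add_comm]; exact hn, hcop.symm, ?_⟩
    rw [cu, cv, abs_of_pos su, abs_of_neg sv]; push_cast; rw [hz2]; ring
  · refine ⟨_, _, hU, hV, hn, hcop, ?_⟩
    rw [cu, cv, abs_of_pos su, abs_of_pos sv]; exact hz

theorem cnpt_unit (c a b : ℕ) (h : a ^ 2 + b ^ 2 = c ^ 2) (hab : Nat.Coprime a b) :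
    Nat.Coprime b (c ^ 2) := by
  rw [← h]
  have : Nat.Coprime b (a ^ 2) := (Nat.Coprime.pow_left 2 hab).symm
  rw [pow_two b]
  exact (Nat.coprime_add_mul_left_right b (a ^ 2) b).mpr this

theorem cnpt_total (c : ℕ) (hc : 1 < c) (hmod : ∀ p ∈ c.primeFactors, p % 4 = 1)
    (hodd : c % 2 = 1) :
    {ab : ℕ × ℕ | 0 < ab.1 ∧ 0 < ab.2 ∧ ab.1 ^ 2 + ab.2 ^ 2 = c ^ 2 ∧
        Nat.Coprime ab.1 ab.2}.ncard = 2 ^ c.primeFactors.card := by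
  have hr := cnpt_roots (c ^ 2) (by positivity)
    (by rw [Nat.primeFactors_pow _ two_ne_zero]; exact hmod)
  rw [Nat.primeFactors_pow _ two_ne_zero] at hr
  rw [← hr]
  refine Set.ncard_congr (fun ab _ => (ab.1 : ZMod (c ^ 2)) * (ab.2 : ZMod (c ^ 2))⁻¹) ?_ ?_ ?_
  · rintro ⟨a, b⟩ ⟨-, -, h, hab⟩
    have hu := ZMod.coe_mul_inv_eq_one b (cnpt_unit c a b h hab)
    have hz : (a : ZMod (c ^ 2)) ^ 2 + (b : ZMod (c ^ 2)) ^ 2 = 0 := by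
      have := congrArg (Nat.cast : ℕ → ZMod (c ^ 2)) h
      rw [ZMod.natCast_self] at this
      exact_mod_cast this
    simp only [Set.mem_setOf_eq] at *
    generalize ((b : ZMod (c ^ 2))⁻¹) = i at *
    linear_combination i ^ 2 * hz - (b * i + 1) * hu
  · rintro ⟨a, b⟩ ⟨a', b'⟩ ⟨ha, hb, h, hab⟩ ⟨ha', hb', h', hab'⟩ heq
    simp only at *
    have hu := ZMod.coe_mul_inv_eq_one b (cnpt_unit c a b h hab)
    have hu' := ZMod.coe_mul_inv_eq_one b' (cnpt_unit c a' b' h' hab')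
    have hz : ((a * b' : ℕ) : ZMod (c ^ 2)) = ((a' * b : ℕ) : ZMod (c ^ 2)) := by
      push_cast
      generalize ((b : ZMod (c ^ 2))⁻¹) = i at *
      generalize ((b' : ZMod (c ^ 2))⁻¹) = i' at *
      linear_combination b * b' * heq - a * b' * hu + a' * b * hu'
    have l1 : a < c := by nlinarith
    have l2 : b < c := by nlinarith
    have l3 : a' < c := by nlinarith
    have l4 : b' < c := by nlinarith
    rw [ZMod.natCast_eq_natCast_iff] at hz
    have he : a * b' = a' * b := Nat.ModEq.eq_of_lt_of_lt hz (by nlinarith) (by nlinarith)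
    have d1 : a ∣ a' := hab.dvd_of_dvd_mul_right (Dvd.intro _ he)
    have d2 : a' ∣ a := hab'.dvd_of_dvd_mul_right (Dvd.intro _ he.symm)
    have e := Nat.dvd_antisymm d1 d2
    subst e
    have : b' = b := Nat.eq_of_mul_eq_mul_left ha he
    rw [this]
  · intro x hx
    obtain ⟨a, b, ha, hb, h, hab, hz⟩ := cnpt_surj c hc hodd x hx
    refine ⟨(a, b), ⟨ha, hb, h, hab⟩, ?_⟩
    have hu := ZMod.coe_mul_inv_eq_one b (cnpt_unit c a b h hab)
    simp only
    rw [hz, mul_assoc, hu, mul_one]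

/-- **Theorem 5.3(1) of Yekutieli (counting part).**
Let `c > 1` be an integer all of whose (distinct) prime factors are `≡ 1 (mod 4)`.  Then the
number of normalized Pythagorean triples of the form `(a, b, c)`, i.e. pairs of positive
integers `(a, b)` with `a² + b² = c²`, `gcd(a, b, c) = 1` and `a ≤ b`, is exactly
`2 ^ (k - 1)`, where `k` is the number of distinct prime factors of `c`. -/
theorem count_normalized_pythagorean_triples
    (c : ℕ) (hc : 1 < c)
    (hmod : ∀ p ∈ c.primeFactors, p % 4 = 1) :
    {ab : ℕ × ℕ | 0 < ab.1 ∧ 0 < ab.2 ∧ ab.1 ≤ ab.2 ∧ ab.1 ^ 2 + ab.2 ^ 2 = c ^ 2 ∧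
        Nat.gcd (Nat.gcd ab.1 ab.2) c = 1}.ncard
      = 2 ^ (c.primeFactors.card - 1) := by
  have hodd : c % 2 = 1 := by
    by_contra h
    have := hmod 2 (Nat.mem_primeFactors.mpr ⟨Nat.prime_two, by omega, by omega⟩)
    omega
  have ht := cnpt_total c hc hmod hodd
  set S := {ab : ℕ × ℕ | 0 < ab.1 ∧ 0 < ab.2 ∧ ab.1 ≤ ab.2 ∧ ab.1 ^ 2 + ab.2 ^ 2 = c ^ 2 ∧
        Nat.gcd (Nat.gcd ab.1 ab.2) c = 1} with hS
  have hfin : S.Finite := by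
    refine ((Set.finite_Iic c).prod (Set.finite_Iic c)).subset ?_
    rintro ⟨a, b⟩ ⟨-, -, -, h, -⟩
    simp only at h
    constructor
    · show a ≤ c
      nlinarith
    · show b ≤ c
      nlinarith
  have hg : ∀ a b : ℕ, a ^ 2 + b ^ 2 = c ^ 2 → (Nat.gcd (Nat.gcd a b) c = 1 ↔ Nat.Coprime a b) := by
    intro a b h
    have : Nat.gcd a b ∣ c := by
      rw [← Nat.pow_dvd_pow_iff two_ne_zero, ← h]
      exact dvd_add (pow_dvd_pow_of_dvd (Nat.gcd_dvd_left a b) 2)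
        (pow_dvd_pow_of_dvd (Nat.gcd_dvd_right a b) 2)
    rw [Nat.gcd_eq_left this]
  have hun : {ab : ℕ × ℕ | 0 < ab.1 ∧ 0 < ab.2 ∧ ab.1 ^ 2 + ab.2 ^ 2 = c ^ 2 ∧
        Nat.Coprime ab.1 ab.2} = S ∪ Prod.swap '' S := by
    ext ⟨a, b⟩
    constructor
    · rintro ⟨ha, hb, h, hab⟩
      simp only at *
      rcases le_total a b with hl | hl
      · exact Or.inl ⟨ha, hb, hl, h, (hg a b h).mpr hab⟩
      · have h' : b ^ 2 + a ^ 2 = c ^ 2 := by rw [add_comm]; exact h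
        exact Or.inr ⟨(b, a), ⟨hb, ha, hl, h', (hg b a h').mpr hab.symm⟩, rfl⟩
    · rintro (⟨ha, hb, hl, h, hab⟩ | ⟨⟨b', a'⟩, ⟨hb, ha, hl, h, hab⟩, he⟩)
      · exact ⟨ha, hb, h, (hg a b h).mp hab⟩
      · obtain ⟨rfl, rfl⟩ := Prod.mk.inj he
        exact ⟨ha, hb, by rw [add_comm]; exact h, ((hg _ _ h).mp hab).symm⟩
  have hdis : Disjoint S (Prod.swap '' S) := by
    rw [Set.disjoint_left]
    rintro ⟨a, b⟩ ⟨ha, hb, hl, h, hab⟩ ⟨⟨b', a'⟩, ⟨_, _, hl', _, _⟩, he⟩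
    obtain ⟨rfl, rfl⟩ := Prod.mk.inj he
    simp only at *
    obtain rfl := le_antisymm hl hl'
    have := congrArg (· % 2) h
    simp [Nat.pow_mod, hodd, ← two_mul] at this
  rw [hun, Set.ncard_union_eq hdis hfin (hfin.image _),
    Set.ncard_image_of_injective _ Prod.swap_injective] at ht
  have hk : 0 < c.primeFactors.card := Finset.card_pos.mpr (Nat.nonempty_primeFactors.mpr hc)
  obtain ⟨k, hk⟩ : ∃ k, c.primeFactors.card = k + 1 := ⟨_, (Nat.succ_pred_eq_of_pos hk).symm⟩
  rw [hk, pow_succ] at ht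
  rw [hk, Nat.add_sub_cancel]
  omega
end
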